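/- Let φ ∈ Cⁿ(Ω) have compact support contained in Ω. Then the mixed derivative v = D^{(1,…,1)}φ = ∂ⁿφ/∂x₁…∂xₙ satisfies: (1) for every 1 ≤ i ≤ n, ∫_{a_i}^{b_i} v(x₁,…,ξ_i,…,xₙ) dξ_i = 0 for all values of the remaining coordinates (i.e., v ∈ L₀), and (2) φ = T v on Ω, that is, φ(x) = ∫_{aₙ}^{xₙ} … ∫_{a₁}^{x₁} v(ξ₁,…,ξₙ) dξ₁ … dξₙ for all x ∈ Ω. -/

import Mathlib

open MeasureTheory Filter Set Topology
open scoped ENNReal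

noncomputable section

/-- The open box `Ω = ∏ᵢ (aᵢ, bᵢ)` in `ℝⁿ`. -/
def boxΩ {n : ℕ} (a b : Fin n → ℝ) : Set (Fin n → ℝ) :=
  Set.univ.pi fun i => Set.Ioo (a i) (b i)

/-- Lebesgue measure restricted to the box. -/
def boxμ {n : ℕ} (a b : Fin n → ℝ) : Measure (Fin n → ℝ) :=
  volume.restrict (boxΩ a b)

/-- A test function: infinitely differentiable with compact support contained in `Ω`. -/
def IsTest {n : ℕ} (Ω : Set (Fin n → ℝ)) (φ : (Fin n → ℝ) → ℝ) : Prop :=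
  ContDiff ℝ (⊤ : ℕ∞) φ ∧ HasCompactSupport φ ∧ tsupport φ ⊆ Ω

/-- The classical mixed partial derivative `D^α f` where the multi-index
`α ∈ {0,1}ⁿ` is encoded by the set `s` of coordinates with `αᵢ = 1`. -/
def mder {n : ℕ} (s : Finset (Fin n)) (f : (Fin n → ℝ) → ℝ) : (Fin n → ℝ) → ℝ :=
  (s.sort (· ≤ ·)).foldr (fun i g x => fderiv ℝ g x (Pi.single i 1)) f

/-- `w` is the weak derivative `D^α u` on `Ω` (w.r.t. the measure `μ`),
where `α ∈ {0,1}ⁿ` is encoded by `s`. -/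
def IsWeakDeriv {n : ℕ} (μ : Measure (Fin n → ℝ)) (Ω : Set (Fin n → ℝ))
    (s : Finset (Fin n)) (u w : (Fin n → ℝ) → ℝ) : Prop :=
  ∀ φ : (Fin n → ℝ) → ℝ, IsTest Ω φ →
    ∫ x, u x * mder s φ x ∂μ = (-1 : ℝ) ^ s.card * ∫ x, w x * φ x ∂μ
/-- Integration of the `i`-th coordinate over its full range `(aᵢ, bᵢ)`. -/
def Sone {n : ℕ} (a b : Fin n → ℝ) (i : Fin n) (v : (Fin n → ℝ) → ℝ) :
    (Fin n → ℝ) → ℝ :=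
  fun x => ∫ t in (a i)..(b i), v (Function.update x i t)

/-- The operator `S_α`: integration over all coordinates in `s`, each over its
full range; the multi-index `α ∈ {0,1}ⁿ` is encoded by the set `s` of
coordinates with `αᵢ = 1`. -/
def Sop {n : ℕ} (a b : Fin n → ℝ) (s : Finset (Fin n)) (v : (Fin n → ℝ) → ℝ) :
    (Fin n → ℝ) → ℝ :=
  (s.sort (· ≤ ·)).foldr (Sone a b) v

/-- Membership in the subspace `L₀ = {v ∈ L²(Ω) : Sᵢ v = 0 a.e. for all i}`. -/
def MemL0 {n : ℕ} (μ : Measure (Fin n → ℝ)) (a b : Fin n → ℝ)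
    (v : (Fin n → ℝ) → ℝ) : Prop :=
  ∀ i : Fin n, ∀ᵐ x ∂μ, Sone a b i v x = 0
/-- The Volterra-type operator `Tᵢ`: integration of the `i`-th coordinate from
`aᵢ` to `xᵢ`. -/
def Tone {n : ℕ} (a : Fin n → ℝ) (i : Fin n) (v : (Fin n → ℝ) → ℝ) :
    (Fin n → ℝ) → ℝ :=
  fun x => ∫ t in (a i)..(x i), v (Function.update x i t)

/-- The operator `T_α = T_{i₁} ∘ … ∘ T_{i_k}` where `i₁ < … < i_k` are the
nonzero components of `α ∈ {0,1}ⁿ`, encoded by the set `s`. -/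
def Tmul {n : ℕ} (a : Fin n → ℝ) (s : Finset (Fin n)) (v : (Fin n → ℝ) → ℝ) :
    (Fin n → ℝ) → ℝ :=
  (s.sort (· ≤ ·)).foldr (Tone a) v

/-- The partial derivative of `f` in the `i`-th coordinate. -/
def partialDeriv {n : ℕ} (i : Fin n) (f : (Fin n → ℝ) → ℝ) : (Fin n → ℝ) → ℝ :=
  fun x => fderiv ℝ f x (Pi.single i 1)

theorem mder_eq_foldr {n : ℕ} (s : Finset (Fin n)) (f : (Fin n → ℝ) → ℝ) :
    mder s f = (s.sort (· ≤ ·)).foldr partialDeriv f := rfl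

theorem ContDiff.partialDeriv {n : ℕ} {f : (Fin n → ℝ) → ℝ} {k : ℕ}
    (hf : ContDiff ℝ ((k + 1 : ℕ) : WithTop ℕ∞) f) (i : Fin n) :
    ContDiff ℝ k (partialDeriv i f) :=
  (hf.fderiv_right (by norm_cast)).clm_apply contDiff_const

theorem ContDiff.foldr_partialDeriv {n : ℕ} {f : (Fin n → ℝ) → ℝ} {k : ℕ} (l : List (Fin n))
    (hf : ContDiff ℝ ((k + l.length : ℕ) : WithTop ℕ∞) f) :
    ContDiff ℝ k (l.foldr _root_.partialDeriv f) := by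
  induction l generalizing k with
  | nil => simpa using hf
  | cons i l ih =>
    refine ContDiff.partialDeriv (ih ?_) i
    rwa [add_right_comm, add_assoc]

theorem tsupport_partialDeriv_subset {n : ℕ} (i : Fin n) (f : (Fin n → ℝ) → ℝ) :
    tsupport (partialDeriv i f) ⊆ tsupport f :=
  tsupport_fderiv_apply_subset ℝ (Pi.single i 1)

theorem tsupport_foldr_partialDeriv_subset {n : ℕ} (l : List (Fin n)) (f : (Fin n → ℝ) → ℝ) :
    tsupport (l.foldr partialDeriv f) ⊆ tsupport f := by
  induction l with
  | nil => rfl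
  | cons i l ih => exact (tsupport_partialDeriv_subset i _).trans ih

theorem partialDeriv_comm {n : ℕ} {f : (Fin n → ℝ) → ℝ} (hf : ContDiff ℝ 2 f) (i j : Fin n) :
    partialDeriv i (partialDeriv j f) = partialDeriv j (partialDeriv i f) := by
  have hd : Differentiable ℝ (fderiv ℝ f) :=
    (hf.fderiv_right (m := 1) (by norm_num)).differentiable (by norm_num)
  have second (i j : Fin n) (x : Fin n → ℝ) : partialDeriv i (partialDeriv j f) x =
      fderiv ℝ (fderiv ℝ f) x (Pi.single i 1) (Pi.single j 1) := by
    unfold partialDeriv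
    rw [fderiv_clm_apply (hd x) (differentiableAt_const _)]
    simp
  ext x
  rw [second, second]
  exact (hf.contDiffAt.isSymmSndFDerivAt (by simp)) _ _

theorem foldr_partialDeriv_perm {n : ℕ} {f : (Fin n → ℝ) → ℝ} {l l' : List (Fin n)}
    (h : l.Perm l') (hf : ContDiff ℝ l.length f) :
    l.foldr partialDeriv f = l'.foldr partialDeriv f := by
  induction h with
  | nil => rfl
  | cons i _ ih =>
    exact congrArg (partialDeriv i) (ih (hf.of_le (by simp)))
  | swap i j l =>
    refine partialDeriv_comm (ContDiff.foldr_partialDeriv (k := 2) l ?_) j i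
    rwa [add_comm]
  | trans h _ ih ih' => exact (ih hf).trans (ih' (by rwa [← h.length_eq]))

theorem integral_partialDeriv_update {n : ℕ} {f : (Fin n → ℝ) → ℝ} (hf : ContDiff ℝ 1 f)
    (i : Fin n) (x : Fin n → ℝ) (s t : ℝ) :
    ∫ u in s..t, partialDeriv i f (Function.update x i u) =
      f (Function.update x i t) - f (Function.update x i s) := by
  refine intervalIntegral.integral_eq_sub_of_hasDerivAt
    (f := fun u => f (Function.update x i u)) (fun u _ => ?_) ?_
  · exact ((hf.differentiable (by norm_num)) _).hasFDerivAt.comp_hasDerivAt u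
      (hasDerivAt_update x i u)
  · have hc : Continuous (partialDeriv i f) :=
      (ContDiff.partialDeriv (k := 0) (by simpa using hf) i).continuous
    exact (hc.comp (continuous_const.update i continuous_id)).intervalIntegrable _ _

theorem eq_zero_of_notMem_Ioo {n : ℕ} {a b : Fin n → ℝ} {f : (Fin n → ℝ) → ℝ}
    (hf : tsupport f ⊆ boxΩ a b) {x : Fin n → ℝ} {i : Fin n} (hx : x i ∉ Ioo (a i) (b i)) :
    f x = 0 :=
  image_eq_zero_of_notMem_tsupport fun h => hx (hf h i (mem_univ i))

theorem Sone_partialDeriv {n : ℕ} {a b : Fin n → ℝ} {f : (Fin n → ℝ) → ℝ}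
    (hf : ContDiff ℝ 1 f) (hsub : tsupport f ⊆ boxΩ a b) (i : Fin n) :
    Sone a b i (partialDeriv i f) = 0 := by
  ext x
  rw [Sone, integral_partialDeriv_update hf,
    eq_zero_of_notMem_Ioo hsub (i := i) (by simp),
    eq_zero_of_notMem_Ioo hsub (i := i) (by simp), sub_zero, Pi.zero_apply]

theorem Tone_partialDeriv {n : ℕ} {a b : Fin n → ℝ} {f : (Fin n → ℝ) → ℝ}
    (hf : ContDiff ℝ 1 f) (hsub : tsupport f ⊆ boxΩ a b) (i : Fin n) :
    Tone a i (partialDeriv i f) = f := by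
  ext x
  rw [Tone, integral_partialDeriv_update hf, Function.update_eq_self,
    eq_zero_of_notMem_Ioo hsub (x := Function.update x i (a i)) (i := i) (by simp), sub_zero]

theorem foldr_Tone_foldr_partialDeriv_reverse {n : ℕ} {a b : Fin n → ℝ}
    {f : (Fin n → ℝ) → ℝ} (l : List (Fin n)) (hf : ContDiff ℝ l.length f)
    (hsub : tsupport f ⊆ boxΩ a b) :
    l.foldr (Tone a) (l.reverse.foldr partialDeriv f) = f := by
  induction l generalizing f with
  | nil => rfl
  | cons i l ih =>
    rw [List.reverse_cons, List.foldr_append, List.foldr_cons, List.foldr_cons, List.foldr_nil,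
      ih (ContDiff.partialDeriv hf i) ((tsupport_partialDeriv_subset i f).trans hsub)]
    exact Tone_partialDeriv (hf.of_le (by simp)) hsub i

theorem Sone_mder {n : ℕ} {a b : Fin n → ℝ} {f : (Fin n → ℝ) → ℝ} {s : Finset (Fin n)}
    (hf : ContDiff ℝ s.card f) (hsub : tsupport f ⊆ boxΩ a b) {i : Fin n} (hi : i ∈ s) :
    Sone a b i (mder s f) = 0 := by
  have hperm := List.perm_cons_erase ((Finset.mem_sort (· ≤ ·)).2 hi)
  have hlen : (s.sort (· ≤ ·)).length = s.card := Finset.length_sort _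
  rw [mder_eq_foldr, foldr_partialDeriv_perm hperm (by rwa [hlen])]
  refine Sone_partialDeriv (ContDiff.foldr_partialDeriv (k := 1) _ ?_)
    ((tsupport_foldr_partialDeriv_subset _ f).trans hsub) i
  rwa [add_comm, ← List.length_cons, ← hperm.length_eq, hlen]

theorem Tmul_mder {n : ℕ} {a b : Fin n → ℝ} {f : (Fin n → ℝ) → ℝ} {s : Finset (Fin n)}
    (hf : ContDiff ℝ s.card f) (hsub : tsupport f ⊆ boxΩ a b) :
    Tmul a s (mder s f) = f := by
  rw [← Finset.length_sort (· ≤ ·)] at hf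
  rw [mder_eq_foldr, foldr_partialDeriv_perm (List.reverse_perm _).symm hf]
  exact foldr_Tone_foldr_partialDeriv_reverse _ hf hsub

/-- If `φ ∈ Cⁿ(Ω)` has compact support contained in `Ω`, then the mixed
derivative `v = D^{(1,…,1)}φ` satisfies: (1) `v` integrates to zero over each
coordinate's full range (so `v ∈ L₀`), and (2) `φ = T v` on `Ω`. -/
theorem statement19 {n : ℕ} (a b : Fin n → ℝ) (hab : ∀ i, a i < b i)
    (φ : (Fin n → ℝ) → ℝ) (hφ : ContDiff ℝ n φ)
    (hsupp : HasCompactSupport φ) (hsub : tsupport φ ⊆ boxΩ a b) :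
    (∀ i : Fin n, ∀ x ∈ boxΩ a b, Sone a b i (mder Finset.univ φ) x = 0) ∧
    MemL0 (boxμ a b) a b (mder Finset.univ φ) ∧
    (∀ x ∈ boxΩ a b, φ x = Tmul a Finset.univ (mder Finset.univ φ) x) := by
  have hcard : ContDiff ℝ (Finset.univ : Finset (Fin n)).card φ := by simpa using hφ
  have hS (i : Fin n) : Sone a b i (mder Finset.univ φ) = 0 :=
    Sone_mder hcard hsub (Finset.mem_univ i)
  exact ⟨fun i x _ => congrFun (hS i) x, fun i => .of_forall (congrFun (hS i)),
    fun x _ => (congrFun (Tmul_mder hcard hsub) x).symm⟩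


end
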